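/- For every a with 0 < a < 1, exp(5√5 · ∫_0^a f(-q^5)^5 / f(-q) dq) = (125 + 11u + 5√5·√(125 + 22u + u²)) / ((11 + 5√5)·u), where u = u(a). -/

import Mathlib

open MeasureTheory Real

/-- Euler's product `f(-q) = ∏_{n=1}^∞ (1 - qⁿ)`. -/
noncomputable def eulerF (q : ℝ) : ℝ := ∏' n : ℕ, (1 - q ^ (n + 1))

/-- `u(q) = f(-q)⁶ / (q · f(-q⁵)⁶)`. -/
noncomputable def uF (q : ℝ) : ℝ := eulerF q ^ 6 / (q * eulerF (q ^ 5) ^ 6)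

open Filter Topology Set

/-! ### Moments of the alternating theta series -/

/-- A series of real exponentials can be differentiated termwise in the interior of its domain of
convergence. -/
theorem hasDerivAt_tsum_mul_exp {ι : Type*} {c μ : ι → ℝ} {r : ℝ}
    (h : ∀ᶠ x in 𝓝 r, Summable fun i => c i * exp (μ i * x)) :
    HasDerivAt (fun x => ∑' i, c i * exp (μ i * x)) (∑' i, c i * μ i * exp (μ i * r)) r := by
  obtain ⟨δ, hδ, hball⟩ := Metric.eventually_nhds_iff.1 h
  obtain ⟨ε, hε, rfl⟩ : ∃ ε, 0 < ε ∧ 3 * ε = δ := ⟨δ / 3, by positivity, by ring⟩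
  have hp := (hball (y := r + 2 * ε) (by
    simp [abs_of_pos hε]; linarith)).norm
  have hm := (hball (y := r - 2 * ε) (by
    simp [abs_of_pos hε]; linarith)).norm
  refine hasDerivAt_tsum_of_isPreconnected (t := Metric.ball r ε)
    (g := fun i x => c i * exp (μ i * x)) (g' := fun i x => c i * μ i * exp (μ i * x))
    ((hp.add hm).mul_left ε⁻¹) Metric.isOpen_ball (convex_ball r ε).isPreconnected
    (fun i y _ => ?_) (fun i y hy => ?_) (Metric.mem_ball_self hε)
    (hball (by simpa using hε)) (Metric.mem_ball_self hε)
  · have h1 : HasDerivAt (fun x => c i * exp (μ i * x)) (c i * (exp (μ i * y) * (μ i * 1))) y :=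
      (((hasDerivAt_id y).const_mul (μ i)).exp).const_mul (c i)
    exact h1.congr_deriv (by ring)
  · have hμ : ε * |μ i| ≤ exp (ε * |μ i|) := by linarith [add_one_le_exp (ε * |μ i|)]
    have hy' : μ i * y ≤ μ i * r + ε * |μ i| := by
      have h2 : μ i * (y - r) ≤ |μ i| * ε := by
        refine (le_abs_self _).trans ?_
        rw [abs_mul]
        exact mul_le_mul_of_nonneg_left (by simpa [Real.dist_eq] using hy.le) (abs_nonneg _)
      nlinarith
    have key : |μ i| * exp (μ i * y) ≤
        ε⁻¹ * (exp (μ i * (r + 2 * ε)) + exp (μ i * (r - 2 * ε))) := by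
      rw [le_inv_mul_iff₀ hε, ← mul_assoc]
      calc ε * |μ i| * exp (μ i * y)
          ≤ exp (ε * |μ i|) * exp (μ i * r + ε * |μ i|) := by gcongr
        _ = exp (μ i * r + 2 * (ε * |μ i|)) := by rw [← exp_add]; ring_nf
        _ ≤ exp (μ i * (r + 2 * ε)) + exp (μ i * (r - 2 * ε)) := by
          rcases abs_cases (μ i) with ⟨h3, -⟩ | ⟨h3, -⟩ <;> rw [h3]
          · have := exp_pos (μ i * (r - 2 * ε))
            ring_nf at this ⊢; linarith
          · have := exp_pos (μ i * (r + 2 * ε))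
            ring_nf at this ⊢; linarith
    simp only [norm_mul, Real.norm_eq_abs, abs_exp]
    calc |c i| * |μ i| * exp (μ i * y) = |c i| * (|μ i| * exp (μ i * y)) := by ring
      _ ≤ |c i| * (ε⁻¹ * (exp (μ i * (r + 2 * ε)) + exp (μ i * (r - 2 * ε)))) := by gcongr
      _ = _ := by ring

/-- The `j`-th moment `∑ₙ (-1)ⁿ nʲ exp (s n - t n (n - 1) / 2)` of the theta series, that is,
`∑ₙ (-1)ⁿ nʲ p^(n(n-1)/2) xⁿ` with `x = exp s` and nome `p = exp (-t)`. -/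
noncomputable def thetaMoment (j : ℕ) (s t : ℝ) : ℝ :=
  ∑' n : ℤ, (-1) ^ n * (n : ℝ) ^ j * exp (s * n - t * (n * (n - 1) / 2))

theorem abs_neg_one_zpow_real (n : ℤ) : |(-1 : ℝ) ^ n| = 1 := by
  rw [abs_zpow]; simp

theorem summable_abs_pow_mul_exp {t : ℝ} (ht : 0 < t) (j : ℕ) (s : ℝ) :
    Summable fun n : ℤ => |(n : ℝ)| ^ j * exp (s * n - t * (n * (n - 1) / 2)) := by
  have h := summable_pow_mul_jacobiTheta₂_term_bound ((|s| + t / 2) / (2 * π))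
    (T := t / (2 * π)) (by positivity) j
  refine Summable.of_nonneg_of_le (fun n => by positivity) (fun n => ?_) h
  push_cast
  gcongr
  have h1 : -π * (t / (2 * π) * (n : ℝ) ^ 2 - 2 * ((|s| + t / 2) / (2 * π)) * |(n : ℝ)|) =
      -(t / 2) * (n : ℝ) ^ 2 + (|s| + t / 2) * |(n : ℝ)| := by
    field_simp; ring
  rw [h1]
  have h2 : s * n ≤ |s| * |(n : ℝ)| := by rw [← abs_mul]; exact le_abs_self _
  have h3 := mul_le_mul_of_nonneg_left (le_abs_self (n : ℝ)) ht.le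
  nlinarith

theorem summable_exp_quadratic {t : ℝ} (ht : 0 < t) (s : ℝ) :
    Summable fun n : ℤ => exp (s * n - t * (n * (n - 1) / 2)) := by
  simpa using summable_abs_pow_mul_exp ht 0 s

theorem summable_thetaMoment {t : ℝ} (ht : 0 < t) (j : ℕ) (s : ℝ) :
    Summable fun n : ℤ => (-1 : ℝ) ^ n * (n : ℝ) ^ j * exp (s * n - t * (n * (n - 1) / 2)) := by
  refine Summable.of_norm ((summable_abs_pow_mul_exp ht j s).congr fun n => ?_)
  rw [norm_mul, norm_mul, Real.norm_eq_abs, abs_neg_one_zpow_real]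
  simp

theorem hasDerivAt_thetaMoment {t : ℝ} (ht : 0 < t) (j : ℕ) (s : ℝ) :
    HasDerivAt (fun s => thetaMoment j s t) (thetaMoment (j + 1) s t) s := by
  have hterm (j : ℕ) (x : ℝ) (n : ℤ) : (-1 : ℝ) ^ n * (n : ℝ) ^ j *
      exp (x * n - t * (n * (n - 1) / 2)) =
      (-1) ^ n * (n : ℝ) ^ j * exp (-(t * (n * (n - 1) / 2))) * exp (n * x) := by
    rw [mul_assoc _ (exp _) (exp _), ← exp_add]; ring_nf
  have h := hasDerivAt_tsum_mul_exp (r := s) (μ := fun n : ℤ => (n : ℝ))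
    (c := fun n : ℤ => (-1 : ℝ) ^ n * (n : ℝ) ^ j * exp (-(t * (n * (n - 1) / 2))))
    (.of_forall fun x => (summable_thetaMoment ht j x).congr fun n => hterm j x n)
  simp only [thetaMoment, hterm]
  refine h.congr_deriv (tsum_congr fun n => by ring)

/-- The heat equation, along a ray through the origin. -/
theorem hasDerivAt_thetaMoment_ray (a : ℝ) {b τ : ℝ} (hb : 0 < b) (hτ : 0 < τ) (j : ℕ) :
    HasDerivAt (fun τ => thetaMoment j (-(a * τ)) (b * τ))
      (-(a * thetaMoment (j + 1) (-(a * τ)) (b * τ) + b / 2 *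
        (thetaMoment (j + 2) (-(a * τ)) (b * τ) - thetaMoment (j + 1) (-(a * τ)) (b * τ)))) τ := by
  have hterm (x : ℝ) (n : ℤ) : -(a * x) * n - b * x * (n * (n - 1) / 2) =
      -(a * n + b * (n * (n - 1) / 2)) * x := by ring
  have h := hasDerivAt_tsum_mul_exp (r := τ)
    (μ := fun n : ℤ => -(a * n + b * ((n : ℝ) * (n - 1) / 2)))
    (c := fun n : ℤ => (-1 : ℝ) ^ n * (n : ℝ) ^ j) (by
      filter_upwards [lt_mem_nhds hτ] with x hx
      refine (summable_thetaMoment (mul_pos hb hx) j (-(a * x))).congr fun n => ?_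
      rw [hterm])
  have h0 : (fun τ => thetaMoment j (-(a * τ)) (b * τ)) = fun x => ∑' n : ℤ,
      (-1 : ℝ) ^ n * (n : ℝ) ^ j * exp (-(a * n + b * ((n : ℝ) * (n - 1) / 2)) * x) := by
    funext x
    simp only [thetaMoment, hterm]
  rw [h0]
  refine h.congr_deriv ?_
  have hbτ := mul_pos hb hτ
  have s1 := summable_thetaMoment hbτ (j + 1) (-(a * τ))
  have s2 := summable_thetaMoment hbτ (j + 2) (-(a * τ))
  simp only [thetaMoment]
  rw [← s2.tsum_sub s1, ← tsum_mul_left, ← tsum_mul_left,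
    ← (s1.mul_left a).tsum_add ((s2.sub s1).mul_left (b / 2)), ← tsum_neg]
  refine tsum_congr fun n => ?_
  rw [hterm]
  ring

theorem thetaMoment_zero_neg (s t : ℝ) :
    thetaMoment 0 (-s) t = -exp (-s) * thetaMoment 0 s t := by
  simp only [thetaMoment]
  rw [← tsum_mul_left, ← (Equiv.subLeft (1 : ℤ)).tsum_eq]
  refine tsum_congr fun n => ?_
  rw [Equiv.subLeft_apply, zpow_sub₀ (by norm_num)]
  have : exp (-s * ((1 - n : ℤ) : ℝ) - t * (((1 - n : ℤ) : ℝ) * (((1 - n : ℤ) : ℝ) - 1) / 2)) =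
      exp (-s) * exp (s * n - t * (n * (n - 1) / 2)) := by
    rw [← exp_add]; push_cast; ring_nf
  rw [this]
  rcases Int.even_or_odd n with h | h <;> simp [h.neg_one_zpow]

theorem thetaMoment_reflect (j : ℕ) (s t : ℝ) :
    thetaMoment j (-t - s) t = (-1) ^ j * thetaMoment j s t := by
  simp only [thetaMoment]
  rw [← tsum_mul_left, ← (Equiv.neg ℤ).tsum_eq]
  refine tsum_congr fun n => ?_
  rw [Equiv.neg_apply, zpow_neg]
  have h1 : ((-1 : ℝ) ^ n)⁻¹ = (-1) ^ n := by rw [← inv_zpow]; norm_num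
  rw [h1]
  push_cast
  rw [neg_pow (n : ℝ)]
  ring_nf

/-! ### The three-term relation -/

/-- Pairs of integers, split by the parity of their sum. -/
theorem bijective_parity_split : Function.Bijective
    (Sum.elim (fun x => (x.1 + x.2, x.1 - x.2)) (fun x => (x.1 + x.2 + 1, x.1 - x.2)) :
      (ℤ × ℤ) ⊕ (ℤ × ℤ) → ℤ × ℤ) := by
  constructor
  · rintro (⟨i, j⟩ | ⟨i, j⟩) (⟨k, l⟩ | ⟨k, l⟩) h <;>
      simp only [Sum.elim_inl, Sum.elim_inr, Prod.mk.injEq] at h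
    · obtain ⟨rfl, rfl⟩ : i = k ∧ j = l := by omega
      rfl
    · omega
    · omega
    · obtain ⟨rfl, rfl⟩ : i = k ∧ j = l := by omega
      rfl
  · rintro ⟨m, n⟩
    rcases Int.even_or_odd' (m + n) with ⟨k, h | h⟩
    · exact ⟨.inl (k, k - n), by simp only [Sum.elim_inl, Prod.mk.injEq]; omega⟩
    · exact ⟨.inr (k, k - n), by simp only [Sum.elim_inr, Prod.mk.injEq]; omega⟩

/-- The product of two theta series is a combination of products of even and odd theta series. -/
theorem thetaMoment_add_mul_sub {t : ℝ} (ht : 0 < t) (a b : ℝ) :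
    thetaMoment 0 (a + b) t * thetaMoment 0 (a - b) t = exp a *
      ((∑' n : ℤ, exp ((2 * n + 1) * a - t * (n ^ 2 + n))) *
          (∑' n : ℤ, exp (2 * n * b - t * n ^ 2)) -
        (∑' n : ℤ, exp (2 * n * a - t * n ^ 2)) *
          (∑' n : ℤ, exp ((2 * n + 1) * b - t * (n ^ 2 + n)))) := by
  have hf (x : ℝ) : Summable fun n : ℤ => exp (2 * n * x - t * n ^ 2) :=
    (summable_exp_quadratic (mul_pos two_pos ht) (2 * x - t)).congr fun n => by ring_nf
  have hg (x : ℝ) : Summable fun n : ℤ => exp ((2 * n + 1) * x - t * (n ^ 2 + n)) :=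
    ((summable_exp_quadratic (mul_pos two_pos ht) (2 * x - 2 * t)).mul_left (exp x)).congr
      fun n => by rw [← exp_add]; ring_nf
  have hshift : ∑' n : ℤ, exp (2 * n * a - t * (n ^ 2 - n)) =
      exp a * ∑' n : ℤ, exp ((2 * n + 1) * a - t * (n ^ 2 + n)) := by
    rw [← tsum_mul_left, ← (Equiv.addRight (1 : ℤ)).tsum_eq]
    refine tsum_congr fun n => ?_
    rw [← exp_add, Equiv.coe_addRight]
    push_cast; ring_nf
  have hh : Summable fun n : ℤ => exp (2 * n * a - t * (n ^ 2 - n)) :=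
    (summable_exp_quadratic (mul_pos two_pos ht) (2 * a)).congr fun n => by ring_nf
  have hodd : ∑' n : ℤ, exp ((2 * n + 1) * a - t * n ^ 2) =
      exp a * ∑' n : ℤ, exp (2 * n * a - t * n ^ 2) := by
    rw [← tsum_mul_left]
    refine tsum_congr fun n => ?_
    rw [← exp_add]; ring_nf
  have hk : Summable fun n : ℤ => exp ((2 * n + 1) * a - t * n ^ 2) :=
    ((hf a).mul_left (exp a)).congr fun n => by rw [← exp_add]; ring_nf
  have s1 := summable_thetaMoment ht 0 (a + b)
  have s2 := summable_thetaMoment ht 0 (a - b)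
  have e1 : ∀ x : ℤ × ℤ,
      (-1 : ℝ) ^ (x.1 + x.2) * ((x.1 + x.2 : ℤ) : ℝ) ^ 0 * exp ((a + b) * ((x.1 + x.2 : ℤ) : ℝ) -
        t * (((x.1 + x.2 : ℤ) : ℝ) * (((x.1 + x.2 : ℤ) : ℝ) - 1) / 2)) *
      ((-1 : ℝ) ^ (x.1 - x.2) * ((x.1 - x.2 : ℤ) : ℝ) ^ 0 * exp ((a - b) * ((x.1 - x.2 : ℤ) : ℝ) -
        t * (((x.1 - x.2 : ℤ) : ℝ) * (((x.1 - x.2 : ℤ) : ℝ) - 1) / 2))) =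
      exp (2 * x.1 * a - t * (x.1 ^ 2 - x.1)) * exp (2 * x.2 * b - t * x.2 ^ 2) := by
    rintro ⟨i, j⟩
    have : (-1 : ℝ) ^ (i + j) * (-1 : ℝ) ^ (i - j) = 1 := by
      rw [← zpow_add₀ (by norm_num), show i + j + (i - j) = 2 * i by ring]
      exact (even_two_mul i).neg_one_zpow
    simp only [pow_zero, mul_one]
    rw [mul_mul_mul_comm, this, one_mul, ← exp_add, ← exp_add]
    push_cast; ring_nf
  have e2 : ∀ x : ℤ × ℤ,
      (-1 : ℝ) ^ (x.1 + x.2 + 1) * ((x.1 + x.2 + 1 : ℤ) : ℝ) ^ 0 *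
        exp ((a + b) * ((x.1 + x.2 + 1 : ℤ) : ℝ) -
        t * (((x.1 + x.2 + 1 : ℤ) : ℝ) * (((x.1 + x.2 + 1 : ℤ) : ℝ) - 1) / 2)) *
      ((-1 : ℝ) ^ (x.1 - x.2) * ((x.1 - x.2 : ℤ) : ℝ) ^ 0 * exp ((a - b) * ((x.1 - x.2 : ℤ) : ℝ) -
        t * (((x.1 - x.2 : ℤ) : ℝ) * (((x.1 - x.2 : ℤ) : ℝ) - 1) / 2))) =
      -(exp ((2 * x.1 + 1) * a - t * x.1 ^ 2) *
        exp ((2 * x.2 + 1) * b - t * (x.2 ^ 2 + x.2))) := by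
    rintro ⟨i, j⟩
    have : (-1 : ℝ) ^ (i + j + 1) * (-1 : ℝ) ^ (i - j) = -1 := by
      rw [← zpow_add₀ (by norm_num), show i + j + 1 + (i - j) = 2 * i + 1 by ring]
      exact (odd_two_mul_add_one i).neg_one_zpow
    simp only [pow_zero, mul_one]
    rw [mul_mul_mul_comm, this, neg_one_mul, ← exp_add, ← exp_add]
    push_cast; ring_nf
  have p1 := summable_mul_of_summable_norm hh.norm (hf b).norm
  have p2 := summable_mul_of_summable_norm hk.norm (hg b).norm
  simp only [thetaMoment]
  rw [tsum_mul_tsum_of_summable_norm s1.norm s2.norm,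
    ← (Equiv.ofBijective _ bijective_parity_split).tsum_eq, Summable.tsum_sum]
  · simp only [Equiv.ofBijective_apply, Sum.elim_inl, Sum.elim_inr, e1, e2, tsum_neg]
    rw [← tsum_mul_tsum_of_summable_norm hh.norm (hf b).norm,
      ← tsum_mul_tsum_of_summable_norm hk.norm (hg b).norm, hshift, hodd]
    ring
  · simp only [Function.comp_def, Equiv.ofBijective_apply, Sum.elim_inl, e1]
    exact p1
  · simp only [Function.comp_def, Equiv.ofBijective_apply, Sum.elim_inr, e2]
    exact p2.neg

/-- Weierstrass' three-term relation for theta functions. -/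
theorem thetaMoment_three_term {t : ℝ} (ht : 0 < t) (x y w : ℝ) :
    exp y * thetaMoment 0 (x + y) t * thetaMoment 0 (x - y) t *
        (thetaMoment 0 w t * thetaMoment 0 (-w) t) -
      thetaMoment 0 x t ^ 2 * (thetaMoment 0 (y + w) t * thetaMoment 0 (y - w) t) +
      thetaMoment 0 (x + w) t * thetaMoment 0 (x - w) t * thetaMoment 0 y t ^ 2 = 0 := by
  have h1 := thetaMoment_add_mul_sub ht x y
  have h2 := thetaMoment_add_mul_sub ht 0 w
  have h3 := thetaMoment_add_mul_sub ht x 0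
  have h4 := thetaMoment_add_mul_sub ht y w
  have h5 := thetaMoment_add_mul_sub ht x w
  have h6 := thetaMoment_add_mul_sub ht y 0
  simp only [zero_add, zero_sub, add_zero, sub_zero, exp_zero, one_mul] at h2 h3 h6
  rw [mul_assoc (exp y), h1, h2, sq, h3, h4, h5, sq, h6]
  ring

theorem hasDerivAt_thetaMoment_neg {t : ℝ} (ht : 0 < t) (j : ℕ) (s : ℝ) :
    HasDerivAt (fun s => thetaMoment j (-s) t) (-thetaMoment (j + 1) (-s) t) s :=
  (HasDerivAt.comp s (hasDerivAt_thetaMoment ht j (-s)) (hasDerivAt_neg s)).congr_deriv (by ring)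

theorem thetaMoment_one_neg {t : ℝ} (ht : 0 < t) (s : ℝ) :
    thetaMoment 1 (-s) t = exp (-s) * (thetaMoment 1 s t - thetaMoment 0 s t) := by
  have h1 : HasDerivAt (fun s => -exp (-s) * thetaMoment 0 s t) _ s :=
    (((hasDerivAt_neg s).exp).neg).mul (hasDerivAt_thetaMoment ht 0 s)
  have h2 := (hasDerivAt_thetaMoment_neg ht 0 s).unique
    (h1.congr_of_eventuallyEq (.of_forall fun s => thetaMoment_zero_neg s t))
  rw [zero_add] at h2
  simp only [Pi.neg_apply] at h2
  linarith

theorem thetaMoment_two_neg {t : ℝ} (ht : 0 < t) (s : ℝ) :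
    thetaMoment 2 (-s) t =
      -exp (-s) * (thetaMoment 2 s t - 2 * thetaMoment 1 s t + thetaMoment 0 s t) := by
  have h1 : HasDerivAt (fun s => exp (-s) * (thetaMoment 1 s t - thetaMoment 0 s t)) _ s :=
    ((hasDerivAt_neg s).exp).mul
      ((hasDerivAt_thetaMoment ht 1 s).sub (hasDerivAt_thetaMoment ht 0 s))
  have h2 := (hasDerivAt_thetaMoment_neg ht 1 s).unique
    (h1.congr_of_eventuallyEq (.of_forall fun s => thetaMoment_one_neg ht s))
  simp only [zero_add, one_add_one_eq_two] at h2
  linarith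

theorem thetaMoment_zero_zero (t : ℝ) : thetaMoment 0 0 t = 0 := by
  have := thetaMoment_zero_neg 0 t
  simp only [neg_zero, exp_zero] at this
  linarith

theorem thetaMoment_two_zero {t : ℝ} (ht : 0 < t) : thetaMoment 2 0 t = thetaMoment 1 0 t := by
  have := thetaMoment_two_neg ht 0
  simp only [neg_zero, exp_zero, thetaMoment_zero_zero] at this
  linarith

/-- The three-term relation, differentiated at a coincidence of two of its arguments. -/
theorem thetaMoment_addition {t : ℝ} (ht : 0 < t) (x y : ℝ) :
    thetaMoment 0 x t ^ 2 * (thetaMoment 1 (x + y) t * thetaMoment 0 (x - y) t +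
        thetaMoment 0 (x + y) t * thetaMoment 1 (x - y) t) -
      2 * thetaMoment 0 x t * thetaMoment 1 x t *
        (thetaMoment 0 (x + y) t * thetaMoment 0 (x - y) t) =
    exp (x - y) * thetaMoment 1 0 t * thetaMoment 0 (2 * x) t * thetaMoment 0 y t ^ 2 := by
  have hd (s : ℝ) : HasDerivAt (fun s => thetaMoment 0 s t) (thetaMoment 1 s t) s :=
    hasDerivAt_thetaMoment ht 0 s
  have hdn : HasDerivAt (fun w => thetaMoment 0 (-w) t) (-thetaMoment 1 (-x) t) x :=
    hasDerivAt_thetaMoment_neg ht 0 x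
  have hda (c : ℝ) : HasDerivAt (fun w => thetaMoment 0 (c + w) t) (thetaMoment 1 (c + x) t) x :=
    (hd (c + x)).comp_const_add c x
  have hds (c : ℝ) : HasDerivAt (fun w => thetaMoment 0 (c - w) t) (-thetaMoment 1 (c - x) t) x :=
    (hd (c - x)).comp_const_sub c x
  have h := (((((hd x).mul hdn).const_mul
      (exp y * thetaMoment 0 (x + y) t * thetaMoment 0 (x - y) t)).sub
    (((hda y).mul (hds y)).const_mul (thetaMoment 0 x t ^ 2))).add
    (((hda x).mul (hds x)).mul_const (thetaMoment 0 y t ^ 2)))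
  have h0 := h.unique ((hasDerivAt_const x (0 : ℝ)).congr_of_eventuallyEq
    (.of_forall fun w => thetaMoment_three_term ht x y w))
  have hyx : y - x = -(x - y) := by ring
  rw [thetaMoment_zero_neg x, thetaMoment_one_neg ht x, sub_self, thetaMoment_zero_zero, hyx,
    thetaMoment_zero_neg (x - y), thetaMoment_one_neg ht (x - y), ← two_mul, add_comm y x,
    ← hyx] at h0
  have he : exp y * exp (-x) = exp (y - x) := by rw [← exp_add]; ring_nf
  have he' : exp (x - y) * exp (y - x) = 1 := by rw [← exp_add]; simp
  linear_combination exp (x - y) * h0 -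
    exp (x - y) * thetaMoment 0 (x + y) t * thetaMoment 0 (x - y) t * thetaMoment 0 x t *
      (thetaMoment 0 x t - 2 * thetaMoment 1 x t) * he + (thetaMoment 0 x t ^ 2 *
      (thetaMoment 1 (x + y) t * thetaMoment 0 (x - y) t +
        thetaMoment 0 (x + y) t * thetaMoment 1 (x - y) t) -
      2 * thetaMoment 0 x t * thetaMoment 1 x t *
        (thetaMoment 0 (x + y) t * thetaMoment 0 (x - y) t)) * (-he')

theorem thetaMoment_addition_deriv {t : ℝ} (ht : 0 < t) (x y : ℝ) :
    thetaMoment 0 x t ^ 2 * (thetaMoment 2 (x + y) t * thetaMoment 0 (x - y) t +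
        2 * thetaMoment 1 (x + y) t * thetaMoment 1 (x - y) t +
        thetaMoment 0 (x + y) t * thetaMoment 2 (x - y) t) -
      2 * (thetaMoment 1 x t ^ 2 + thetaMoment 0 x t * thetaMoment 2 x t) *
        (thetaMoment 0 (x + y) t * thetaMoment 0 (x - y) t) =
    exp (x - y) * thetaMoment 1 0 t *
      (thetaMoment 0 (2 * x) t + 2 * thetaMoment 1 (2 * x) t) * thetaMoment 0 y t ^ 2 := by
  have hd (j : ℕ) : HasDerivAt (fun s => thetaMoment j s t) (thetaMoment (j + 1) x t) x :=
    hasDerivAt_thetaMoment ht j x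
  have hda (j : ℕ) : HasDerivAt (fun s => thetaMoment j (s + y) t)
      (thetaMoment (j + 1) (x + y) t) x := (hasDerivAt_thetaMoment ht j (x + y)).comp_add_const x y
  have hds (j : ℕ) : HasDerivAt (fun s => thetaMoment j (s - y) t)
      (thetaMoment (j + 1) (x - y) t) x := (hasDerivAt_thetaMoment ht j (x - y)).comp_sub_const x y
  have hdd : HasDerivAt (fun s => thetaMoment 0 (2 * s) t) (2 * thetaMoment 1 (2 * x) t) x :=
    (HasDerivAt.comp x (hasDerivAt_thetaMoment ht 0 (2 * x))
      ((hasDerivAt_id x).const_mul 2)).congr_deriv (by ring)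
  have hl := (((hd 0).pow 2).mul (((hda 1).mul (hds 0)).add ((hda 0).mul (hds 1)))).sub
    ((((hd 0).const_mul 2).mul (hd 1)).mul ((hda 0).mul (hds 0)))
  have hr := ((((((hasDerivAt_id x).sub_const y).exp).mul_const (thetaMoment 1 0 t)).mul
    hdd).mul_const (thetaMoment 0 y t ^ 2))
  have h := hl.unique (hr.congr_of_eventuallyEq (.of_forall fun s => thetaMoment_addition ht s y))
  simp only [Pi.mul_apply, Pi.add_apply, Pi.pow_apply, id] at h
  norm_num at h
  linear_combination h

/-! ### Jacobi's triple product -/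

/-- The infinite product `∏ₖ (1 - x pᵏ)` with `x = exp s` and `p = exp (-t)`. -/
noncomputable def pochhammerInf (s t : ℝ) : ℝ := ∏' k : ℕ, (1 - exp (s - t * k))

theorem summable_exp_sub_mul {t : ℝ} (ht : 0 < t) (s : ℝ) :
    Summable fun k : ℕ => exp (s - t * k) := by
  refine ((summable_geometric_of_lt_one (exp_pos (-t)).le
    (exp_lt_one_iff.2 (neg_lt_zero.2 ht))).mul_left (exp s)).congr fun k => ?_
  rw [← exp_nat_mul, ← exp_add]; ring_nf

theorem multipliable_one_sub_exp {t : ℝ} (ht : 0 < t) (s : ℝ) :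
    Multipliable fun k : ℕ => 1 - exp (s - t * k) := by
  simpa [sub_eq_add_neg] using
    Real.multipliable_one_add_of_summable (summable_exp_sub_mul ht s).neg

theorem tendsto_prod_pochhammerInf {t : ℝ} (ht : 0 < t) (s : ℝ) :
    Tendsto (fun n => ∏ k ∈ Finset.range n, (1 - exp (s - t * k))) atTop
      (𝓝 (pochhammerInf s t)) :=
  (multipliable_one_sub_exp ht s).tendsto_prod_tprod_nat

theorem pochhammerInf_pos {s t : ℝ} (ht : 0 < t) (hs : s < 0) : 0 < pochhammerInf s t := by
  have hlog : Summable fun k : ℕ => log (1 - exp (s - t * k)) := by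
    simpa [sub_eq_add_neg] using
      Real.summable_log_one_add_of_summable (summable_exp_sub_mul ht s).neg
  have hpos (k : ℕ) : 0 < 1 - exp (s - t * k) := by
    have : (0 : ℝ) ≤ t * k := by positivity
    exact sub_pos.2 (exp_lt_one_iff.2 (by linarith))
  rw [pochhammerInf, ← Real.rexp_tsum_eq_tprod hpos hlog]
  exact exp_pos _

theorem pochhammerInf_succ {t : ℝ} (ht : 0 < t) (s : ℝ) :
    pochhammerInf s t = (1 - exp s) * pochhammerInf (s - t) t := by
  refine tendsto_nhds_unique ((tendsto_prod_pochhammerInf ht s).comp (tendsto_add_atTop_nat 1)) ?_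
  refine ((tendsto_prod_pochhammerInf ht (s - t)).const_mul (1 - exp s)).congr fun n => ?_
  rw [Function.comp_apply, Finset.prod_range_succ', mul_comm]
  congr 1
  · refine Finset.prod_congr rfl fun k _ => ?_
    push_cast; ring_nf
  · simp

theorem continuous_pochhammerInf {t : ℝ} (ht : 0 < t) :
    Continuous fun s => pochhammerInf s t := by
  rw [continuous_iff_continuousAt]
  intro s
  have h := tendsto_tprod_one_add_of_dominated_convergence (𝓕 := 𝓝 s)
    (f := fun (x : ℝ) (k : ℕ) => -exp (x - t * k)) (g := fun k : ℕ => -exp (s - t * k))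
    (summable_exp_sub_mul ht (s + 1))
    (fun k : ℕ => Continuous.tendsto (by fun_prop : Continuous fun x : ℝ => -exp (x - t * k)) s)
    (by
      filter_upwards [gt_mem_nhds (lt_add_one s)] with x hx k
      rw [norm_neg, Real.norm_eq_abs, abs_exp]
      gcongr)
  simpa only [ContinuousAt, pochhammerInf, sub_eq_add_neg] using h

theorem pochhammerInf_eq_prod_five {t : ℝ} (ht : 0 < t) (s : ℝ) :
    pochhammerInf s t = ∏ i ∈ Finset.range 5, pochhammerInf (s - i * t) (5 * t) := by
  refine tendsto_nhds_unique ((tendsto_prod_pochhammerInf ht s).comp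
    ((tendsto_id).const_mul_atTop' (r := 5) (by norm_num))) ?_
  refine (tendsto_finsetProd (Finset.range 5) fun i _ =>
    tendsto_prod_pochhammerInf (mul_pos (by norm_num : (0 : ℝ) < 5) ht) (s - i * t)).congr fun n => ?_
  simp only [Function.comp_apply, id]
  induction n with
  | zero => simp
  | succ n ih =>
    simp only [Finset.prod_range_succ _ n, Finset.prod_mul_distrib, ih, mul_add, mul_one,
      Finset.prod_range_add]
    congr 1
    refine Finset.prod_congr rfl fun i _ => ?_
    push_cast; ring_nf

theorem eulerF_exp_neg (t : ℝ) : eulerF (exp (-t)) = pochhammerInf (-t) t := by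
  refine tprod_congr fun k => ?_
  rw [← exp_nat_mul]; push_cast; ring_nf

theorem eulerF_exp_neg_pos {t : ℝ} (ht : 0 < t) : 0 < eulerF (exp (-t)) := by
  rw [eulerF_exp_neg]
  exact pochhammerInf_pos ht (neg_lt_zero.2 ht)

/-- The `q`-factorial `∏_{1 ≤ i ≤ m} (1 - pⁱ)` with `p = exp (-t)`. -/
noncomputable def qFactorial (t : ℝ) (m : ℕ) : ℝ := ∏ k ∈ Finset.range m, (1 - exp (-t - t * k))

theorem tendsto_qFactorial {t : ℝ} (ht : 0 < t) :
    Tendsto (qFactorial t) atTop (𝓝 (eulerF (exp (-t)))) := by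
  rw [eulerF_exp_neg]
  exact tendsto_prod_pochhammerInf ht (-t)

theorem qFactorial_succ (t : ℝ) (m : ℕ) :
    qFactorial t (m + 1) = qFactorial t m * (1 - exp (-t * (m + 1))) := by
  rw [qFactorial, Finset.prod_range_succ, ← qFactorial]
  ring_nf

theorem qFactorial_pos {t : ℝ} (ht : 0 < t) (m : ℕ) : 0 < qFactorial t m := by
  refine Finset.prod_pos fun k _ => sub_pos.2 (exp_lt_one_iff.2 ?_)
  have : (0 : ℝ) ≤ t * k := by positivity
  linarith

theorem antitone_qFactorial {t : ℝ} (ht : 0 < t) : Antitone (qFactorial t) := by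
  refine antitone_nat_of_succ_le fun m => ?_
  rw [qFactorial_succ]
  exact mul_le_of_le_one_right (qFactorial_pos ht m).le (by linarith [exp_pos (-t * (m + 1))])

/-- The reciprocal `q`-factorial, extended by zero to negative integers. -/
noncomputable def invQFactorial (t : ℝ) (m : ℤ) : ℝ :=
  if 0 ≤ m then (qFactorial t m.toNat)⁻¹ else 0

theorem invQFactorial_sub_one {t : ℝ} (ht : 0 < t) (m : ℤ) :
    invQFactorial t (m - 1) = (1 - exp (-t * m)) * invQFactorial t m := by
  rcases lt_trichotomy m 0 with h | rfl | h
  · rw [invQFactorial, invQFactorial, if_neg (by omega), if_neg (by omega), mul_zero]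
  · simp [invQFactorial]
  · obtain ⟨k, rfl⟩ : ∃ k : ℕ, m = k + 1 := ⟨(m - 1).toNat, by omega⟩
    have h2 := (qFactorial_pos ht (k + 1)).ne'
    rw [invQFactorial, invQFactorial, if_pos (by omega), if_pos (by omega),
      show ((k : ℤ) + 1 - 1).toNat = k by omega, show ((k : ℤ) + 1).toNat = k + 1 by omega]
    push_cast
    rw [qFactorial_succ, neg_mul] at h2 ⊢
    rw [mul_inv, mul_left_comm, mul_inv_cancel₀ (right_ne_zero_of_mul h2), mul_one]

theorem invQFactorial_nonneg {t : ℝ} (ht : 0 < t) (m : ℤ) : 0 ≤ invQFactorial t m := by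
  unfold invQFactorial
  split_ifs
  · exact (inv_pos.2 (qFactorial_pos ht _)).le
  · exact le_rfl

theorem invQFactorial_le {t : ℝ} (ht : 0 < t) (m : ℤ) :
    invQFactorial t m ≤ (eulerF (exp (-t)))⁻¹ := by
  have hF := eulerF_exp_neg_pos ht
  unfold invQFactorial
  split_ifs
  · exact inv_anti₀ hF ((antitone_qFactorial ht).le_of_tendsto (tendsto_qFactorial ht) _)
  · exact (inv_pos.2 hF).le

theorem tendsto_invQFactorial {t : ℝ} (ht : 0 < t) (j : ℤ) :
    Tendsto (fun n : ℕ => invQFactorial t (n + j)) atTop (𝓝 (eulerF (exp (-t)))⁻¹) := by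
  have h1 : Tendsto (fun n : ℕ => ((n : ℤ) + j).toNat) atTop atTop :=
    tendsto_atTop.2 fun b => by
      filter_upwards [eventually_ge_atTop (b + j.natAbs)] with n hn
      omega
  refine (((tendsto_qFactorial ht).comp h1).inv₀ (eulerF_exp_neg_pos ht).ne').congr' ?_
  filter_upwards [eventually_ge_atTop j.natAbs] with n hn
  rw [invQFactorial, if_pos (by omega), Function.comp_apply]

/-- The finite form of Jacobi's triple product. -/
theorem hasSum_finite_triple_product {t : ℝ} (ht : 0 < t) (s : ℝ) (n : ℕ) :
    HasSum (fun j : ℤ => qFactorial t (2 * n) * invQFactorial t (n - j) * invQFactorial t (n + j) *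
        ((-1) ^ j * exp (s * j - t * (j * (j - 1) / 2))))
      (∏ k ∈ Finset.range n, ((1 - exp (s - t * k)) * (1 - exp (-s - t - t * k)))) := by
  induction n with
  | zero =>
    have h := hasSum_single (f := fun j : ℤ => qFactorial t (2 * 0) *
      invQFactorial t ((0 : ℕ) - j) * invQFactorial t ((0 : ℕ) + j) *
        ((-1) ^ j * exp (s * j - t * (j * (j - 1) / 2)))) 0 fun j hj => by
      rcases hj.lt_or_gt with h | h
      · rw [invQFactorial.eq_1 t ((0 : ℕ) + j), if_neg (by simpa using h)]; simp
      · rw [invQFactorial.eq_1 t ((0 : ℕ) - j), if_neg (by simpa using h)]; simp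
    simpa [invQFactorial, qFactorial] using h
  | succ n ih =>
    have hm := (Equiv.subRight (1 : ℤ)).hasSum_iff.2 ih
    have hp := (Equiv.addRight (1 : ℤ)).hasSum_iff.2 ih
    have h := ((ih.mul_left (1 + exp (-t * (2 * n + 1)))).sub
      (hm.mul_left (exp (s - t * n)))).sub (hp.mul_left (exp (-s - t - t * n)))
    refine (congrArg₂ HasSum (funext fun j => ?_) ?_).mpr h
    · have hj : (-1 : ℝ) ^ (j - 1) = -(-1) ^ j := by
        rw [zpow_sub_one₀ (by norm_num)]; norm_num
      have hj' : (-1 : ℝ) ^ (j + 1) = -(-1) ^ j := by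
        rw [zpow_add_one₀ (by norm_num)]; norm_num
      have e1 : exp (s - t * n) * exp (s * ((j - 1 : ℤ) : ℝ) - t * (((j - 1 : ℤ) : ℝ) *
          (((j - 1 : ℤ) : ℝ) - 1) / 2)) =
          exp (-t * (n + 1 - j)) * exp (s * j - t * (j * (j - 1) / 2)) := by
        rw [← exp_add, ← exp_add]; push_cast; ring_nf
      have e2 : exp (-s - t - t * n) * exp (s * ((j + 1 : ℤ) : ℝ) - t * (((j + 1 : ℤ) : ℝ) *
          (((j + 1 : ℤ) : ℝ) - 1) / 2)) =
          exp (-t * (n + 1 + j)) * exp (s * j - t * (j * (j - 1) / 2)) := by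
        rw [← exp_add, ← exp_add]; push_cast; ring_nf
      have i1 := invQFactorial_sub_one ht (n + 1 - j)
      have i2 := invQFactorial_sub_one ht (n + 1 - j - 1)
      have i3 := invQFactorial_sub_one ht (n + 1 + j)
      have i4 := invQFactorial_sub_one ht (n + 1 + j - 1)
      have r1 : (n : ℤ) - j = n + 1 - j - 1 := by ring
      have r2 : (n : ℤ) + j = n + 1 + j - 1 := by ring
      have r3 : (n : ℤ) - (j - 1) = n + 1 - j := by ring
      have r4 : (n : ℤ) + (j - 1) = n + 1 + j - 1 - 1 := by ring
      have r5 : (n : ℤ) - (j + 1) = n + 1 - j - 1 - 1 := by ring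
      have r6 : (n : ℤ) + (j + 1) = n + 1 + j := by ring
      simp only [Function.comp_apply, Equiv.subRight_apply, Equiv.coe_addRight, hj, hj', r1, r2,
        r3, r4, r5, r6, i2, i4, i1, i3, Nat.cast_succ]
      rw [show 2 * (n + 1) = 2 * n + 1 + 1 by ring, qFactorial_succ, qFactorial_succ]
      have x1 : exp (-t * ((n + 1 - j - 1 : ℤ) : ℝ)) = exp t * exp (-t * (n + 1 - j)) := by
        rw [← exp_add]; push_cast; ring_nf
      have x2 : exp (-t * ((n + 1 + j - 1 : ℤ) : ℝ)) = exp t * exp (-t * (n + 1 + j)) := by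
        rw [← exp_add]; push_cast; ring_nf
      have x3 : exp (-t * (((2 * n + 1 : ℕ) : ℝ) + 1)) =
          exp (-t * (n + 1 - j)) * exp (-t * (n + 1 + j)) := by
        rw [← exp_add]; push_cast; ring_nf
      have x4 : exp (-t * (2 * n + 1)) =
          exp t * exp (-t * (n + 1 - j)) * exp (-t * (n + 1 + j)) := by
        rw [← exp_add, ← exp_add]; ring_nf
      rw [x1, x2, x3]
      push_cast at e1 e2 ⊢
      rw [x4]
      linear_combination
        (-(qFactorial t (2 * n) * invQFactorial t (n + 1 - j) * invQFactorial t (n + 1 + j) *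
          (1 - exp t * exp (-t * (n + 1 + j))) * (1 - exp (-t * (n + 1 + j))) * (-1) ^ j)) * e1 -
        qFactorial t (2 * n) * invQFactorial t (n + 1 - j) * invQFactorial t (n + 1 + j) *
          (1 - exp t * exp (-t * (n + 1 - j))) * (1 - exp (-t * (n + 1 - j))) * (-1) ^ j * e2
    · rw [Finset.prod_range_succ]
      have e : exp (s - t * n) * exp (-s - t - t * n) = exp (-t * (2 * n + 1)) := by
        rw [← exp_add]; ring_nf
      rw [← e]
      ring

/-- Jacobi's triple product. -/
theorem thetaMoment_zero_eq_mul {t : ℝ} (ht : 0 < t) (s : ℝ) :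
    thetaMoment 0 s t = eulerF (exp (-t)) * pochhammerInf s t * pochhammerInf (-s - t) t := by
  have hF := eulerF_exp_neg_pos ht
  have hbound := (summable_exp_quadratic ht s).mul_left
    (qFactorial t 0 * (eulerF (exp (-t)))⁻¹ * (eulerF (exp (-t)))⁻¹)
  have hlim := tendsto_tsum_of_dominated_convergence hbound (𝓕 := atTop)
    (f := fun (n : ℕ) (j : ℤ) => qFactorial t (2 * n) * invQFactorial t (n - j) *
      invQFactorial t (n + j) * ((-1) ^ j * exp (s * j - t * (j * (j - 1) / 2))))
    (g := fun j => eulerF (exp (-t)) * (eulerF (exp (-t)))⁻¹ * (eulerF (exp (-t)))⁻¹ *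
      ((-1) ^ j * exp (s * j - t * (j * (j - 1) / 2))))
    (fun j => ((((tendsto_qFactorial ht).comp
      (tendsto_id.const_mul_atTop' (r := 2) (by norm_num))).mul
      (by simpa only [sub_eq_add_neg] using tendsto_invQFactorial ht (-j))).mul
      (tendsto_invQFactorial ht j)).mul_const _)
    (.of_forall fun n j => by
      rw [norm_mul, norm_mul, norm_mul, norm_mul, Real.norm_eq_abs, Real.norm_eq_abs,
        Real.norm_eq_abs, Real.norm_eq_abs, Real.norm_eq_abs, abs_neg_one_zpow_real, abs_exp,
        one_mul, abs_of_pos (qFactorial_pos ht _), abs_of_nonneg (invQFactorial_nonneg ht _),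
        abs_of_nonneg (invQFactorial_nonneg ht _)]
      have h1 := antitone_qFactorial ht (Nat.zero_le (2 * n))
      have h2 := invQFactorial_le ht (n - j)
      have h3 := invQFactorial_le ht (n + j)
      have h4 := invQFactorial_nonneg ht (n - j)
      have h5 := invQFactorial_nonneg ht (n + j)
      have h6 := (qFactorial_pos ht 0).le
      gcongr)
  simp only [(hasSum_finite_triple_product ht s _).tsum_eq, tsum_mul_left,
    Finset.prod_mul_distrib] at hlim
  have h := tendsto_nhds_unique hlim
    ((tendsto_prod_pochhammerInf ht s).mul (tendsto_prod_pochhammerInf ht (-s - t)))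
  rw [mul_inv_cancel₀ hF.ne', one_mul, inv_mul_eq_iff_eq_mul₀ hF.ne'] at h
  simpa [thetaMoment, mul_assoc] using h

/-- Jacobi's formula for the cube of Euler's product. -/
theorem thetaMoment_one_zero {t : ℝ} (ht : 0 < t) :
    thetaMoment 1 0 t = -eulerF (exp (-t)) ^ 3 := by
  set g : ℝ → ℝ := fun s => eulerF (exp (-t)) * pochhammerInf (s - t) t * pochhammerInf (-s - t) t
  have hg : Continuous g := by
    have := continuous_pochhammerInf ht
    exact (continuous_const.mul (this.comp (by fun_prop : Continuous fun s : ℝ => s - t))).mul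
      (this.comp (by fun_prop : Continuous fun s : ℝ => -s - t))
  have hfg (s : ℝ) : thetaMoment 0 s t = (1 - exp s) * g s := by
    rw [thetaMoment_zero_eq_mul ht, pochhammerInf_succ ht]; ring
  have h1 := hasDerivAt_iff_tendsto_slope.1 (hasDerivAt_thetaMoment ht 0 0)
  have h2 := (hasDerivAt_iff_tendsto_slope.1 ((hasDerivAt_exp 0).const_sub 1)).mul
    (hg.continuousAt (x := 0)).continuousWithinAt.tendsto
  have h3 : thetaMoment (0 + 1) 0 t = -exp 0 * g 0 := by
    refine tendsto_nhds_unique h1 (h2.congr fun s => ?_)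
    simp only [slope_def_field, hfg, exp_zero]
    ring
  rw [zero_add] at h3
  simp only [h3, g, exp_zero, eulerF_exp_neg]
  ring_nf

/-! ### Derivatives of products -/

/-- The Leibniz expression for the `j`-th derivative of a product. -/
noncomputable def leibnizMul (f g : ℕ → ℝ → ℝ) (j : ℕ) (s : ℝ) : ℝ :=
  ∑ i ∈ Finset.HasAntidiagonal.antidiagonal j, (j.choose i.1 : ℝ) * (f i.1 s * g i.2 s)

theorem hasDerivAt_leibnizMul {f g : ℕ → ℝ → ℝ} (hf : ∀ j s, HasDerivAt (f j) (f (j + 1) s) s)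
    (hg : ∀ j s, HasDerivAt (g j) (g (j + 1) s) s) (j : ℕ) (s : ℝ) :
    HasDerivAt (leibnizMul f g j) (leibnizMul f g (j + 1) s) s := by
  have h := HasDerivAt.fun_sum (u := Finset.HasAntidiagonal.antidiagonal j) fun i _ =>
    ((hf i.1 s).mul (hg i.2 s)).const_mul (j.choose i.1 : ℝ)
  refine h.congr_deriv ?_
  rw [leibnizMul, Finset.sum_antidiagonal_choose_succ_mul fun a b => f a s * g b s,
    ← Finset.sum_add_distrib]
  refine Finset.sum_congr rfl fun i hi => ?_
  rw [Nat.choose_symm_of_eq_add (Finset.HasAntidiagonal.mem_antidiagonal.1 hi).symm]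
  ring

theorem eq_of_hasDerivAt_succ {f g : ℕ → ℝ → ℝ} (hf : ∀ j s, HasDerivAt (f j) (f (j + 1) s) s)
    (hg : ∀ j s, HasDerivAt (g j) (g (j + 1) s) s) (h : ∀ s, f 0 s = g 0 s) (j : ℕ) :
    f j = g j := by
  induction j with
  | zero => exact funext h
  | succ j ih => exact funext fun s => (hf j s).unique (ih ▸ hg j s)

/-! ### Theta functions of level five -/

/-- The theta moments with parameter `5τ` at the point `-aτ`. -/
noncomputable def fiveTheta (j : ℕ) (a τ : ℝ) : ℝ := thetaMoment j (-(a * τ)) (5 * τ)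

/-- The logarithmic derivative of the theta function at `-aτ`. -/
noncomputable def fiveThetaLog (a τ : ℝ) : ℝ := fiveTheta 1 a τ / fiveTheta 0 a τ

theorem fiveTheta_pos {a τ : ℝ} (hτ : 0 < τ) (ha : 0 < a) (ha5 : a < 5) :
    0 < fiveTheta 0 a τ := by
  rw [fiveTheta, thetaMoment_zero_eq_mul (by positivity)]
  exact mul_pos (mul_pos (eulerF_exp_neg_pos (by positivity))
    (pochhammerInf_pos (by positivity) (by nlinarith)))
    (pochhammerInf_pos (by positivity) (by nlinarith))

theorem fiveTheta_mul {τ : ℝ} (hτ : 0 < τ) :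
    fiveTheta 0 1 τ * fiveTheta 0 2 τ = eulerF (exp (-τ)) * eulerF (exp (-(5 * τ))) := by
  have h5 : 0 < 5 * τ := by positivity
  rw [fiveTheta, fiveTheta, thetaMoment_zero_eq_mul h5, thetaMoment_zero_eq_mul h5,
    eulerF_exp_neg τ, pochhammerInf_eq_prod_five hτ, eulerF_exp_neg (5 * τ)]
  simp only [Finset.prod_range_succ, Finset.prod_range_zero]
  push_cast
  ring_nf

/-- The theta function of parameter `τ` as a product of theta functions of parameter `5τ`. -/
theorem thetaMoment_eq_prod_five {τ : ℝ} (hτ : 0 < τ) (s : ℝ) :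
    eulerF (exp (-(5 * τ))) ^ 5 * thetaMoment 0 s τ = eulerF (exp (-τ)) * (thetaMoment 0 s (5 * τ) *
      (thetaMoment 0 (-τ + s) (5 * τ) * thetaMoment 0 (-τ - s) (5 * τ) *
        (thetaMoment 0 (-(2 * τ) + s) (5 * τ) * thetaMoment 0 (-(2 * τ) - s) (5 * τ)))) := by
  have h5 : 0 < 5 * τ := by positivity
  simp only [thetaMoment_zero_eq_mul h5, thetaMoment_zero_eq_mul hτ,
    pochhammerInf_eq_prod_five hτ, Finset.prod_range_succ, Finset.prod_range_zero]
  push_cast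
  ring_nf

theorem thetaMoment_three_div_isogeny {τ : ℝ} (hτ : 0 < τ) :
    thetaMoment 3 0 τ / thetaMoment 1 0 τ = thetaMoment 3 0 (5 * τ) / thetaMoment 1 0 (5 * τ) +
      6 * ((fiveTheta 2 1 τ / fiveTheta 0 1 τ - fiveThetaLog 1 τ ^ 2) +
        (fiveTheta 2 2 τ / fiveTheta 0 2 τ - fiveThetaLog 2 τ ^ 2)) := by
  have h5 : 0 < 5 * τ := by positivity
  have hF := eulerF_exp_neg_pos hτ
  have hG := eulerF_exp_neg_pos h5
  have hp (b : ℝ) (j : ℕ) (s : ℝ) : HasDerivAt (fun s => thetaMoment j (-(b * τ) + s) (5 * τ))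
      (thetaMoment (j + 1) (-(b * τ) + s) (5 * τ)) s :=
    (hasDerivAt_thetaMoment h5 j _).comp_const_add _ _
  have hm (b : ℝ) (j : ℕ) (s : ℝ) :
      HasDerivAt (fun s => (-1) ^ j * thetaMoment j (-(b * τ) - s) (5 * τ))
        ((-1) ^ (j + 1) * thetaMoment (j + 1) (-(b * τ) - s) (5 * τ)) s :=
    (((hasDerivAt_thetaMoment h5 j _).comp_const_sub _ _).const_mul _).congr_deriv (by ring)
  have key := eq_of_hasDerivAt_succ
    (fun j s => (hasDerivAt_thetaMoment hτ j s).const_mul (eulerF (exp (-(5 * τ))) ^ 5))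
    (fun j s => (hasDerivAt_leibnizMul (hasDerivAt_thetaMoment h5)
      (hasDerivAt_leibnizMul (hasDerivAt_leibnizMul (hp 1) (hm 1))
        (hasDerivAt_leibnizMul (hp 2) (hm 2))) j s).const_mul (eulerF (exp (-τ))))
    (fun s => by simpa [leibnizMul] using thetaMoment_eq_prod_five hτ s)
  have k1 := congrFun (key 1) 0
  have k3 := congrFun (key 3) 0
  simp [leibnizMul, Finset.Nat.sum_antidiagonal_eq_sum_range_succ_mk, Finset.sum_range_succ,
    thetaMoment_zero_zero, Nat.choose] at k1 k3
  have hT1 := (fiveTheta_pos hτ one_pos (by norm_num)).ne'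
  have hT2 := (fiveTheta_pos (a := 2) hτ two_pos (by norm_num)).ne'
  have hN : thetaMoment 1 0 τ ≠ 0 := by simp [thetaMoment_one_zero hτ, hF.ne']
  have hN5 : thetaMoment 1 0 (5 * τ) ≠ 0 := by simp [thetaMoment_one_zero h5, hG.ne']
  rw [div_eq_iff hN]
  refine mul_left_cancel₀ (pow_ne_zero 5 hG.ne') ?_
  rw [mul_left_comm, k1, k3]
  simp only [fiveThetaLog, fiveTheta, one_mul] at hT1 hT2 ⊢
  generalize thetaMoment 0 (-τ) (5 * τ) = x at *
  generalize thetaMoment 0 (-(2 * τ)) (5 * τ) = y at *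
  generalize thetaMoment 1 0 (5 * τ) = z at *
  field_simp
  ring

theorem fiveTheta_addition_one {τ : ℝ} (hτ : 0 < τ) :
    fiveTheta 0 1 τ ^ 2 * (fiveTheta 0 1 τ * fiveTheta 0 2 τ - 3 * (fiveTheta 1 1 τ * fiveTheta 0 2 τ)
      - fiveTheta 0 1 τ * fiveTheta 1 2 τ) =
    eulerF (exp (-(5 * τ))) ^ 3 * fiveTheta 0 2 τ ^ 3 := by
  have h5 : 0 < 5 * τ := by positivity
  have h := thetaMoment_addition h5 (-(1 * τ)) (-(2 * τ))
  have r0 := thetaMoment_reflect 0 (-(2 * τ)) (5 * τ)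
  have r1 := thetaMoment_reflect 1 (-(2 * τ)) (5 * τ)
  have n0 := thetaMoment_zero_neg (-(1 * τ)) (5 * τ)
  have n1 := thetaMoment_one_neg h5 (-(1 * τ))
  rw [show -(1 * τ) + -(2 * τ) = -(5 * τ) - -(2 * τ) by ring,
    show -(1 * τ) - -(2 * τ) = - -(1 * τ) by ring, show 2 * -(1 * τ) = -(2 * τ) by ring, r0, r1,
    n0, n1, thetaMoment_one_zero h5] at h
  have he := (exp_pos (- -(1 * τ))).ne'
  refine mul_left_cancel₀ he ?_
  simp only [fiveTheta]
  linear_combination -h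

theorem fiveTheta_addition_two {τ : ℝ} (hτ : 0 < τ) :
    fiveTheta 0 2 τ ^ 2 * (3 * (fiveTheta 0 1 τ * fiveTheta 1 2 τ) -
      fiveTheta 1 1 τ * fiveTheta 0 2 τ) =
    exp (-τ) * eulerF (exp (-(5 * τ))) ^ 3 * fiveTheta 0 1 τ ^ 3 := by
  have h5 : 0 < 5 * τ := by positivity
  have h := thetaMoment_addition h5 (-(2 * τ)) (-(1 * τ))
  have r0 := thetaMoment_reflect 0 (-(2 * τ)) (5 * τ)
  have r1 := thetaMoment_reflect 1 (-(2 * τ)) (5 * τ)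
  have r0' := thetaMoment_reflect 0 (-(1 * τ)) (5 * τ)
  rw [show -(2 * τ) + -(1 * τ) = -(5 * τ) - -(2 * τ) by ring,
    show -(2 * τ) - -(1 * τ) = -(1 * τ) by ring,
    show 2 * -(2 * τ) = -(5 * τ) - -(1 * τ) by ring, r0, r1, r0', thetaMoment_one_zero h5] at h
  simp only [fiveTheta]
  rw [one_mul] at h ⊢
  linear_combination -h

theorem fiveTheta_addition_deriv {τ : ℝ} (hτ : 0 < τ) :
    fiveTheta 0 1 τ ^ 2 * (fiveTheta 2 2 τ * fiveTheta 0 1 τ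
        + 2 * (fiveTheta 1 2 τ * (fiveTheta 1 1 τ - fiveTheta 0 1 τ))
        + fiveTheta 0 2 τ * (fiveTheta 2 1 τ - 2 * fiveTheta 1 1 τ + fiveTheta 0 1 τ))
      - 2 * (fiveTheta 1 1 τ ^ 2 + fiveTheta 0 1 τ * fiveTheta 2 1 τ)
        * (fiveTheta 0 1 τ * fiveTheta 0 2 τ) =
    eulerF (exp (-(5 * τ))) ^ 3 * ((fiveTheta 0 2 τ + 2 * fiveTheta 1 2 τ) * fiveTheta 0 2 τ ^ 2) := by
  have h5 : 0 < 5 * τ := by positivity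
  have h := thetaMoment_addition_deriv h5 (-(1 * τ)) (-(2 * τ))
  have r0 := thetaMoment_reflect 0 (-(2 * τ)) (5 * τ)
  have r1 := thetaMoment_reflect 1 (-(2 * τ)) (5 * τ)
  have r2 := thetaMoment_reflect 2 (-(2 * τ)) (5 * τ)
  have n0 := thetaMoment_zero_neg (-(1 * τ)) (5 * τ)
  have n1 := thetaMoment_one_neg h5 (-(1 * τ))
  have n2 := thetaMoment_two_neg h5 (-(1 * τ))
  rw [show -(1 * τ) + -(2 * τ) = -(5 * τ) - -(2 * τ) by ring,
    show -(1 * τ) - -(2 * τ) = - -(1 * τ) by ring, show 2 * -(1 * τ) = -(2 * τ) by ring, r0, r1,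
    r2, n0, n1, n2, thetaMoment_one_zero h5] at h
  have he := (exp_pos (- -(1 * τ))).ne'
  refine mul_left_cancel₀ he ?_
  simp only [fiveTheta]
  linear_combination -h

/-- The level five Hauptmodul `q (T₁ / T₂)⁵` (fifth power of the Rogers-Ramanujan continued
fraction) at `q = exp (-τ)`. -/
noncomputable def hauptmodul (τ : ℝ) : ℝ := exp (-τ) * (fiveTheta 0 1 τ / fiveTheta 0 2 τ) ^ 5

/-- The weight two form `q f(-q⁵)⁵ / f(-q)` at `q = exp (-τ)`. -/
noncomputable def weightTwo (τ : ℝ) : ℝ :=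
  exp (-τ) * eulerF (exp (-(5 * τ))) ^ 5 / eulerF (exp (-τ))

theorem fiveThetaLog_relations {τ : ℝ} (hτ : 0 < τ) :
    ∃ A B : ℝ, A ≠ 0 ∧ fiveThetaLog 1 τ = (3 - 3 * A - B) / 10 ∧
      fiveThetaLog 2 τ = (1 + 3 * B - A) / 10 ∧ hauptmodul τ * A = B ∧ weightTwo τ = A * B ∧
      fiveTheta 2 1 τ / fiveTheta 0 1 τ - fiveThetaLog 1 τ ^ 2 =
        fiveTheta 2 2 τ / fiveTheta 0 2 τ - fiveThetaLog 2 τ ^ 2 - A * B := by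
  have h5 : 0 < 5 * τ := by positivity
  have hT1 := (fiveTheta_pos hτ one_pos (by norm_num)).ne'
  have hT2 := (fiveTheta_pos (a := 2) hτ two_pos (by norm_num)).ne'
  have hF := (eulerF_exp_neg_pos hτ).ne'
  have hG := (eulerF_exp_neg_pos h5).ne'
  have hm := fiveTheta_mul hτ
  have a1 := fiveTheta_addition_one hτ
  have a2 := fiveTheta_addition_two hτ
  have a3 := fiveTheta_addition_deriv hτ
  rw [weightTwo]
  generalize eulerF (exp (-(5 * τ))) = G at *
  have hA : 1 - 3 * fiveThetaLog 1 τ - fiveThetaLog 2 τ =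
      G ^ 3 * fiveTheta 0 2 τ ^ 2 / fiveTheta 0 1 τ ^ 3 := by
    unfold fiveThetaLog
    field_simp
    linear_combination a1
  have hB : 3 * fiveThetaLog 2 τ - fiveThetaLog 1 τ =
      exp (-τ) * G ^ 3 * fiveTheta 0 1 τ ^ 2 / fiveTheta 0 2 τ ^ 3 := by
    unfold fiveThetaLog
    field_simp
    linear_combination a2
  refine ⟨1 - 3 * fiveThetaLog 1 τ - fiveThetaLog 2 τ, 3 * fiveThetaLog 2 τ - fiveThetaLog 1 τ,
    ?_, by ring, by ring, ?_, ?_, ?_⟩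
  · rw [hA]; positivity
  · rw [hA, hB, hauptmodul]
    field_simp
  · rw [hA, hB]
    field_simp
    linear_combination hm
  · have hdiff : fiveTheta 2 2 τ / fiveTheta 0 2 τ - fiveTheta 2 1 τ / fiveTheta 0 1 τ
        + 2 * (fiveThetaLog 2 τ * (fiveThetaLog 1 τ - 1)) - 2 * fiveThetaLog 1 τ + 1
        - 2 * fiveThetaLog 1 τ ^ 2 =
        (1 + 2 * fiveThetaLog 2 τ) * (1 - 3 * fiveThetaLog 1 τ - fiveThetaLog 2 τ) := by
      rw [hA]
      unfold fiveThetaLog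
      field_simp
      linear_combination a3
    linear_combination -hdiff

theorem hasDerivAt_fiveTheta (a : ℝ) {τ : ℝ} (hτ : 0 < τ) :
    HasDerivAt (fiveTheta 0 a)
      (-(5 / 2 * fiveTheta 2 a τ + (a - 5 / 2) * fiveTheta 1 a τ)) τ :=
  (hasDerivAt_thetaMoment_ray a (by norm_num : (0 : ℝ) < 5) hτ 0).congr_deriv (by
    simp only [fiveTheta]; ring)

theorem hasDerivAt_thetaMoment_one_zero {b τ : ℝ} (hb : 0 < b) (hτ : 0 < τ) :
    HasDerivAt (fun τ => thetaMoment 1 0 (b * τ))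
      (-(b / 2 * (thetaMoment 3 0 (b * τ) - thetaMoment 1 0 (b * τ)))) τ := by
  have h := hasDerivAt_thetaMoment_ray 0 hb hτ 1
  simp only [zero_mul, neg_zero, zero_add] at h
  refine h.congr_deriv ?_
  rw [thetaMoment_two_zero (by positivity)]

theorem hasDerivAt_exp_neg (τ : ℝ) : HasDerivAt (fun τ => exp (-τ)) (-exp (-τ)) τ :=
  ((hasDerivAt_neg τ).exp).congr_deriv (by ring)

theorem hasDerivAt_hauptmodul {τ : ℝ} (hτ : 0 < τ) :
    HasDerivAt hauptmodul
      (-(weightTwo τ * (1 - 11 * hauptmodul τ - hauptmodul τ ^ 2))) τ := by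
  have hT1 := (fiveTheta_pos hτ one_pos (by norm_num)).ne'
  have hT2 := (fiveTheta_pos (a := 2) hτ two_pos (by norm_num)).ne'
  obtain ⟨A, B, hA, h1, h2, hk, hw, hD⟩ := fiveThetaLog_relations hτ
  have h := (hasDerivAt_exp_neg τ).mul
    (((hasDerivAt_fiveTheta 1 hτ).div (hasDerivAt_fiveTheta 2 hτ) hT2).pow 5)
  refine h.congr_deriv ?_
  have e11 : fiveTheta 1 1 τ = fiveThetaLog 1 τ * fiveTheta 0 1 τ := by
    rw [fiveThetaLog, div_mul_cancel₀ _ hT1]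
  have e12 : fiveTheta 1 2 τ = fiveThetaLog 2 τ * fiveTheta 0 2 τ := by
    rw [fiveThetaLog, div_mul_cancel₀ _ hT2]
  have e21 : fiveTheta 2 1 τ = (fiveTheta 2 2 τ / fiveTheta 0 2 τ - fiveThetaLog 2 τ ^ 2 - A * B
      + fiveThetaLog 1 τ ^ 2) * fiveTheta 0 1 τ := by
    rw [← hD, sub_add_cancel, div_mul_cancel₀ _ hT1]
  have hw' : weightTwo τ * (1 - 11 * hauptmodul τ - hauptmodul τ ^ 2) =
      hauptmodul τ * (A ^ 2 - 11 * A * B - B ^ 2) := by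
    rw [hw, ← hk]; ring
  rw [hw', e21, e11, e12, h1, h2, hauptmodul]
  simp only [Pi.div_apply, Pi.pow_apply, Nat.reduceSub, Nat.cast_ofNat]
  field_simp
  ring

/-- The function `q f(-q⁵)⁶ / f(-q)⁶` at `q = exp (-τ)`, in terms of theta moments. -/
theorem eulerF_quotient_eq {τ : ℝ} (hτ : 0 < τ) :
    exp (-τ) * (thetaMoment 1 0 (5 * τ) / thetaMoment 1 0 τ) ^ 2 =
      exp (-τ) * eulerF (exp (-(5 * τ))) ^ 6 / eulerF (exp (-τ)) ^ 6 := by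
  rw [thetaMoment_one_zero hτ, thetaMoment_one_zero (by positivity : 0 < 5 * τ)]
  ring

theorem hasDerivAt_eulerF_quotient {τ : ℝ} (hτ : 0 < τ) :
    HasDerivAt (fun τ => exp (-τ) * (thetaMoment 1 0 (5 * τ) / thetaMoment 1 0 τ) ^ 2)
      (-(exp (-τ) * (thetaMoment 1 0 (5 * τ) / thetaMoment 1 0 τ) ^ 2 *
        (weightTwo τ * (hauptmodul τ + (hauptmodul τ)⁻¹)))) τ := by
  have h5 : 0 < 5 * τ := by positivity
  have hF := (eulerF_exp_neg_pos hτ).ne'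
  have hG := (eulerF_exp_neg_pos h5).ne'
  have hT1 := (fiveTheta_pos hτ one_pos (by norm_num)).ne'
  have hT2 := (fiveTheta_pos (a := 2) hτ two_pos (by norm_num)).ne'
  have hN : thetaMoment 1 0 τ ≠ 0 := by simp [thetaMoment_one_zero hτ, hF]
  have hN5 : thetaMoment 1 0 (5 * τ) ≠ 0 := by simp [thetaMoment_one_zero h5, hG]
  obtain ⟨A, B, hA, h1, h2, hk, hw, hD⟩ := fiveThetaLog_relations hτ
  have hk0 : hauptmodul τ ≠ 0 := by
    rw [hauptmodul]; positivity
  have d1 := hasDerivAt_thetaMoment_one_zero one_pos hτ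
  have d5 := hasDerivAt_thetaMoment_one_zero (by norm_num : (0 : ℝ) < 5) hτ
  simp only [one_mul] at d1
  have h := (hasDerivAt_exp_neg τ).mul ((d5.div d1 hN).pow 2)
  refine h.congr_deriv ?_
  have iso := thetaMoment_three_div_isogeny hτ
  have hlog : 3 * ((5 / 2 * (fiveTheta 2 1 τ / fiveTheta 0 1 τ) - 3 / 2 * fiveThetaLog 1 τ) +
      (5 / 2 * (fiveTheta 2 2 τ / fiveTheta 0 2 τ) - 1 / 2 * fiveThetaLog 2 τ)) =
      1 / 2 * (thetaMoment 3 0 τ / thetaMoment 1 0 τ - 1) +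
      5 / 2 * (thetaMoment 3 0 (5 * τ) / thetaMoment 1 0 (5 * τ) - 1) := by
    have e : (fun τ => (fiveTheta 0 1 τ * fiveTheta 0 2 τ) ^ 3) =ᶠ[𝓝 τ]
        fun τ => thetaMoment 1 0 τ * thetaMoment 1 0 (5 * τ) := by
      filter_upwards [lt_mem_nhds hτ] with σ hσ
      rw [fiveTheta_mul hσ, thetaMoment_one_zero hσ,
        thetaMoment_one_zero (by positivity : 0 < 5 * σ)]
      ring
    have u := ((((hasDerivAt_fiveTheta 1 hτ).mul (hasDerivAt_fiveTheta 2 hτ)).pow 3).congr_of_eventuallyEq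
      e.symm).unique (d1.mul d5)
    have e0 : (fiveTheta 0 1 τ * fiveTheta 0 2 τ) ^ 3 =
        thetaMoment 1 0 τ * thetaMoment 1 0 (5 * τ) := e.self_of_nhds
    rw [Pi.mul_apply] at u
    have e1 : (fiveTheta 0 1 τ * fiveTheta 0 2 τ) ^ 2 =
      thetaMoment 1 0 τ * thetaMoment 1 0 (5 * τ) / (fiveTheta 0 1 τ * fiveTheta 0 2 τ) := by
      rw [← e0]; field_simp
    norm_num at u
    rw [e1] at u
    unfold fiveThetaLog
    generalize thetaMoment 1 0 (5 * τ) = N5 at *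
    field_simp at u ⊢
    linear_combination -u
  have hE : 5 * (thetaMoment 3 0 (5 * τ) / thetaMoment 1 0 (5 * τ) - 1)
      - (thetaMoment 3 0 τ / thetaMoment 1 0 τ - 1) + 1 = A ^ 2 + B ^ 2 := by
    rw [h1, h2] at iso hlog
    linear_combination -4 / 3 * hlog - 5 / 3 * iso
  have hE' : weightTwo τ * (hauptmodul τ + (hauptmodul τ)⁻¹) = A ^ 2 + B ^ 2 := by
    rw [hw, ← hk]; field_simp; ring
  rw [hE', ← hE]
  simp only [Pi.div_apply, Pi.pow_apply, Nat.reduceSub, Nat.cast_ofNat]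
  generalize thetaMoment 1 0 (5 * τ) = N5 at *
  generalize thetaMoment 3 0 (5 * τ) = M5 at *
  field_simp
  ring

/-! ### Behaviour as `q` tends to zero -/

theorem tendsto_pochhammerInf_atTop {b c : ℝ} (hb : 0 < b) (hc : 0 < c) :
    Tendsto (fun τ => pochhammerInf (-(b * τ)) (c * τ)) atTop (𝓝 1) := by
  have h := tendsto_tprod_one_add_of_dominated_convergence (𝓕 := atTop)
    (f := fun (τ : ℝ) (k : ℕ) => -exp (-(b * τ) - c * τ * k)) (g := fun _ : ℕ => 0)
    (summable_exp_sub_mul hc (-b))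
    (fun k => by
      have hk : 0 < b + c * k := by positivity
      have h1 := ((tendsto_exp_neg_atTop_nhds_zero.comp
        (tendsto_id.const_mul_atTop hk))).neg
      rw [neg_zero] at h1
      refine h1.congr fun τ => ?_
      simp only [Function.comp_apply, id]
      ring_nf)
    (by
      filter_upwards [eventually_ge_atTop 1] with τ hτ k
      rw [norm_neg, Real.norm_eq_abs, abs_exp, exp_le_exp]
      have hk : 0 < b + c * k := by positivity
      nlinarith)
  simpa only [pochhammerInf, sub_eq_add_neg, add_zero, tprod_one] using h

theorem tendsto_eulerF_atTop {c : ℝ} (hc : 0 < c) :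
    Tendsto (fun τ => eulerF (exp (-(c * τ)))) atTop (𝓝 1) := by
  simpa only [eulerF_exp_neg] using tendsto_pochhammerInf_atTop hc hc

theorem tendsto_fiveTheta_atTop {a : ℝ} (ha : 0 < a) (ha5 : a < 5) :
    Tendsto (fiveTheta 0 a) atTop (𝓝 1) := by
  have h := ((tendsto_eulerF_atTop (by norm_num : (0 : ℝ) < 5)).mul
    (tendsto_pochhammerInf_atTop ha (by norm_num : (0 : ℝ) < 5))).mul
    (tendsto_pochhammerInf_atTop (sub_pos.2 ha5) (by norm_num : (0 : ℝ) < 5))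
  rw [one_mul, one_mul] at h
  refine h.congr' ?_
  filter_upwards [eventually_gt_atTop 0] with τ hτ
  rw [fiveTheta, thetaMoment_zero_eq_mul (by positivity)]
  ring_nf

theorem hauptmodul_pos {τ : ℝ} (hτ : 0 < τ) : 0 < hauptmodul τ := by
  have hT1 := fiveTheta_pos hτ one_pos (by norm_num)
  have hT2 := fiveTheta_pos (a := 2) hτ two_pos (by norm_num)
  rw [hauptmodul]
  positivity

theorem tendsto_hauptmodul_atTop : Tendsto hauptmodul atTop (𝓝 0) := by
  have h := tendsto_exp_neg_atTop_nhds_zero.mul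
    (((tendsto_fiveTheta_atTop one_pos (by norm_num)).div
      (tendsto_fiveTheta_atTop two_pos (by norm_num)) one_ne_zero).pow 5)
  change Tendsto (fun τ => exp (-τ) * (fiveTheta 0 1 τ / fiveTheta 0 2 τ) ^ 5) atTop (𝓝 0)
  simpa using h

/-- The relation between the two Hauptmoduln of level five. -/
theorem eulerF_quotient_mul_hauptmodul {τ : ℝ} (hτ : 0 < τ) :
    exp (-τ) * eulerF (exp (-(5 * τ))) ^ 6 / eulerF (exp (-τ)) ^ 6 *
      (1 - 11 * hauptmodul τ - hauptmodul τ ^ 2) = hauptmodul τ := by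
  set x : ℝ → ℝ := fun τ => exp (-τ) * (thetaMoment 1 0 (5 * τ) / thetaMoment 1 0 τ) ^ 2
  set y : ℝ → ℝ := fun τ => x τ / hauptmodul τ * (1 - 11 * hauptmodul τ - hauptmodul τ ^ 2)
  have hy (σ : ℝ) (hσ : 0 < σ) : HasDerivAt y 0 σ := by
    have hk := hasDerivAt_hauptmodul hσ
    have hk0 := (hauptmodul_pos hσ).ne'
    refine (((hasDerivAt_eulerF_quotient hσ).div hk hk0).mul
      (((hk.const_mul 11).const_sub 1).sub (hk.pow 2))).congr_deriv ?_
    simp only [Pi.div_apply, Pi.pow_apply, Pi.sub_apply, Nat.reduceSub, Nat.cast_ofNat]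
    field_simp
    ring
  have hconst (σ : ℝ) (hσ : 0 < σ) : y σ = y τ :=
    isOpen_Ioi.is_const_of_deriv_eq_zero isPreconnected_Ioi
      (fun σ hσ => (hy σ hσ).differentiableAt.differentiableWithinAt)
      (fun σ hσ => (hy σ hσ).deriv) hσ hτ
  have hlim : Tendsto y atTop (𝓝 1) := by
    have hT1 := tendsto_fiveTheta_atTop one_pos (by norm_num)
    have hT2 := tendsto_fiveTheta_atTop two_pos (by norm_num)
    have h := ((((tendsto_eulerF_atTop (by norm_num : (0 : ℝ) < 5)).pow 6).div
      ((tendsto_eulerF_atTop one_pos).pow 6) (by norm_num)).mul ((hT2.div hT1 one_ne_zero).pow 5)).mul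
      ((tendsto_hauptmodul_atTop.const_mul 11).const_sub 1 |>.sub (tendsto_hauptmodul_atTop.pow 2))
    norm_num at h
    refine h.congr' ?_
    filter_upwards [eventually_gt_atTop 0] with σ hσ
    have hT1 := (fiveTheta_pos hσ one_pos (by norm_num)).ne'
    have hT2 := (fiveTheta_pos (a := 2) hσ two_pos (by norm_num)).ne'
    simp only [y, x]
    rw [eulerF_quotient_eq hσ]
    congr 1
    rw [hauptmodul]
    field_simp
  have h1 : y τ = 1 := tendsto_nhds_unique
    (tendsto_const_nhds.congr' (by
      filter_upwards [eventually_gt_atTop 0] with σ hσ using (hconst σ hσ).symm)) hlim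
  simp only [y, x] at h1
  rw [eulerF_quotient_eq hτ, div_mul_eq_mul_div, div_eq_one_iff_eq (hauptmodul_pos hτ).ne'] at h1
  exact h1

/-! ### The integral -/

theorem continuousOn_eulerF : ContinuousOn eulerF (Ico 0 1) := by
  intro x hx
  obtain ⟨r, hxr, hr⟩ := exists_between hx.2
  have h := tendsto_tprod_one_add_of_dominated_convergence (𝓕 := 𝓝[Ico 0 1] x)
    (f := fun (q : ℝ) (k : ℕ) => -q ^ (k + 1)) (g := fun k : ℕ => -x ^ (k + 1))
    ((summable_nat_add_iff 1).2 (summable_geometric_of_lt_one (hx.1.trans hxr.le) hr))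
    (fun k => (Continuous.tendsto (by fun_prop) x).mono_left nhdsWithin_le_nhds)
    (by
      filter_upwards [self_mem_nhdsWithin, nhdsWithin_le_nhds (gt_mem_nhds hxr)] with q hq hqr k
      rw [norm_neg, norm_pow, Real.norm_eq_abs, abs_of_nonneg hq.1]
      exact pow_le_pow_left₀ hq.1 hqr.le _)
  change Tendsto (fun q : ℝ => ∏' n : ℕ, (1 - q ^ (n + 1))) _ (𝓝 (∏' n : ℕ, (1 - x ^ (n + 1))))
  simpa only [sub_eq_add_neg] using h

theorem eulerF_pos {q : ℝ} (hq : 0 ≤ q) (hq1 : q < 1) : 0 < eulerF q := by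
  rcases hq.eq_or_lt with rfl | h
  · simp [eulerF]
  · have := eulerF_exp_neg_pos (neg_pos.2 (log_neg h hq1))
    rwa [neg_neg, exp_log h] at this

theorem continuousOn_eulerF_div {a : ℝ} (ha1 : a < 1) :
    ContinuousOn (fun q => eulerF (q ^ 5) ^ 5 / eulerF q) (Icc 0 a) := by
  have hmem : ∀ q ∈ Icc 0 a, q ∈ Ico (0 : ℝ) 1 := fun q hq => ⟨hq.1, hq.2.trans_lt ha1⟩
  refine ContinuousOn.div (ContinuousOn.pow (continuousOn_eulerF.comp (by fun_prop)
    fun q hq => ⟨pow_nonneg hq.1 5, pow_lt_one₀ hq.1 (hmem q hq).2 (by norm_num)⟩) 5)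
    (continuousOn_eulerF.mono hmem) fun q hq => (eulerF_pos hq.1 (hmem q hq).2).ne'

theorem exp_neg_five_mul_neg_log {q : ℝ} (hq : 0 < q) : exp (-(5 * -log q)) = q ^ 5 := by
  rw [mul_neg, neg_neg, ← exp_log hq, ← exp_nat_mul, exp_log hq]
  norm_num

theorem hasDerivAt_hauptmodul_neg_log {q : ℝ} (hq : 0 < q) (hq1 : q < 1) :
    HasDerivAt (fun q => hauptmodul (-log q)) (eulerF (q ^ 5) ^ 5 / eulerF q *
      (1 - 11 * hauptmodul (-log q) - hauptmodul (-log q) ^ 2)) q := by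
  have hτ := neg_pos.2 (log_neg hq hq1)
  have h := (hasDerivAt_hauptmodul hτ).comp q (hasDerivAt_log hq.ne').neg
  refine h.congr_deriv ?_
  rw [weightTwo, exp_neg_five_mul_neg_log hq, neg_neg, exp_log hq]
  field_simp

theorem uF_mul_hauptmodul {q : ℝ} (hq : 0 < q) (hq1 : q < 1) :
    uF q * hauptmodul (-log q) = 1 - 11 * hauptmodul (-log q) - hauptmodul (-log q) ^ 2 := by
  have h := eulerF_quotient_mul_hauptmodul (neg_pos.2 (log_neg hq hq1))
  rw [exp_neg_five_mul_neg_log hq, neg_neg, exp_log hq] at h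
  have hF := (eulerF_pos hq.le hq1).ne'
  have hG := (eulerF_pos (pow_nonneg hq.le 5) (pow_lt_one₀ hq.le hq1 (by norm_num))).ne'
  rw [uF]
  conv_lhs => rw [← h]
  field_simp

/-- The integral in terms of the Hauptmodul. -/
theorem exp_integral_eq_hauptmodul {a : ℝ} (ha : 0 < a) (ha1 : a < 1) :
    0 < 1 - (11 + 5 * √5) / 2 * hauptmodul (-log a) ∧
    exp (5 * √5 * ∫ q in (0 : ℝ)..a, eulerF (q ^ 5) ^ 5 / eulerF q) =
      (1 + (5 * √5 - 11) / 2 * hauptmodul (-log a)) /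
        (1 - (11 + 5 * √5) / 2 * hauptmodul (-log a)) := by
  have h5 : √5 ^ 2 = 5 := sq_sqrt (by norm_num)
  have h5' : 11 / 5 < √5 := lt_sqrt_of_sq_lt (by norm_num)
  set k : ℝ → ℝ := fun q => hauptmodul (-log q)
  have hk (q : ℝ) (hq : 0 < q) (hq1 : q < 1) : 0 < k q :=
    hauptmodul_pos (neg_pos.2 (log_neg hq hq1))
  have hnum (q : ℝ) (hq : 0 < q) (hq1 : q < 1) : 0 < 1 + (5 * √5 - 11) / 2 * k q := by
    nlinarith [hk q hq hq1]
  have hfactor (q : ℝ) : 1 - 11 * k q - k q ^ 2 =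
      (1 + (5 * √5 - 11) / 2 * k q) * (1 - (11 + 5 * √5) / 2 * k q) := by
    linear_combination (25 / 4 * k q ^ 2) * h5
  have hden (q : ℝ) (hq : 0 < q) (hq1 : q < 1) : 0 < 1 - (11 + 5 * √5) / 2 * k q := by
    have hu : 0 < uF q := div_pos (pow_pos (eulerF_pos hq.le hq1) 6) (mul_pos hq (pow_pos
      (eulerF_pos (pow_nonneg hq.le 5) (pow_lt_one₀ hq.le hq1 (by norm_num))) 6))
    refine pos_of_mul_pos_right ?_ (hnum q hq hq1).le
    rw [← hfactor, ← uF_mul_hauptmodul hq hq1]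
    exact mul_pos hu (hk q hq hq1)
  refine ⟨hden a ha ha1, ?_⟩
  set H : ℝ → ℝ := fun q =>
    log (1 + (5 * √5 - 11) / 2 * k q) - log (1 - (11 + 5 * √5) / 2 * k q)
  have hH (q : ℝ) (hq : 0 < q) (hq1 : q < 1) :
      HasDerivAt H (5 * √5 * (eulerF (q ^ 5) ^ 5 / eulerF q)) q := by
    have hd := hasDerivAt_hauptmodul_neg_log hq hq1
    have h1 := (hnum q hq hq1).ne'
    have h2 := (hden q hq hq1).ne'
    refine (((hd.const_mul _).const_add 1).log h1 |>.sub
      (((hd.const_mul _).const_sub 1).log h2)).congr_deriv ?_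
    change (5 * √5 - 11) / 2 * (eulerF (q ^ 5) ^ 5 / eulerF q * (1 - 11 * k q - k q ^ 2)) /
        (1 + (5 * √5 - 11) / 2 * k q) -
      -((11 + 5 * √5) / 2 * (eulerF (q ^ 5) ^ 5 / eulerF q * (1 - 11 * k q - k q ^ 2))) /
        (1 - (11 + 5 * √5) / 2 * k q) = _
    rw [hfactor]
    generalize eulerF (q ^ 5) ^ 5 / eulerF q = w
    generalize k q = z at h1 h2 ⊢
    have h3 : (5 * √5 - 11) / 2 = 5 * √5 - (11 + 5 * √5) / 2 := by ring
    rw [h3] at h1 ⊢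
    generalize (11 + 5 * √5) / 2 = c at h1 h2 ⊢
    rw [div_sub_div _ _ h1 h2, div_eq_iff (mul_ne_zero h1 h2)]
    ring
  have hlim : Tendsto H (𝓝[>] 0) (𝓝 0) := by
    have h0 : Tendsto k (𝓝[>] 0) (𝓝 0) :=
      tendsto_hauptmodul_atTop.comp (tendsto_neg_atBot_atTop.comp tendsto_log_nhdsGT_zero)
    have h1 := ((h0.const_mul ((5 * √5 - 11) / 2)).const_add 1).log (by norm_num)
    have h2 := ((h0.const_mul ((11 + 5 * √5) / 2)).const_sub 1).log (by norm_num)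
    simpa using h1.sub h2
  have hint : IntervalIntegrable (fun q => 5 * √5 * (eulerF (q ^ 5) ^ 5 / eulerF q)) volume 0 a :=
    (continuousOn_const.mul (continuousOn_eulerF_div ha1)).intervalIntegrable_of_Icc ha.le
  have hFTC := intervalIntegral.integral_eq_sub_of_hasDerivAt_of_tendsto ha
    (fun q hq => hH q hq.1 (hq.2.trans ha1)) hint hlim
    ((hH a ha ha1).continuousAt.tendsto.mono_left nhdsWithin_le_nhds)
  rw [intervalIntegral.integral_const_mul, sub_zero] at hFTC
  rw [hFTC, exp_sub, exp_log (hnum a ha ha1), exp_log (hden a ha ha1)]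

theorem exp_integral_f5q5 (a : ℝ) (ha : 0 < a) (ha1 : a < 1) :
    Real.exp (5 * Real.sqrt 5 * ∫ q in (0:ℝ)..a, eulerF (q ^ 5) ^ 5 / eulerF q) =
      (125 + 11 * uF a + 5 * Real.sqrt 5 *
          Real.sqrt (125 + 22 * uF a + uF a ^ 2)) /
        ((11 + 5 * Real.sqrt 5) * uF a) := by
  obtain ⟨hden, hI⟩ := exp_integral_eq_hauptmodul ha ha1
  have hk := hauptmodul_pos (neg_pos.2 (log_neg ha ha1))
  have hu := uF_mul_hauptmodul ha ha1
  rw [hI]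
  generalize hauptmodul (-log a) = k at *
  have h5 : √5 ^ 2 = 5 := sq_sqrt (by norm_num)
  have h5' : 11 / 5 < √5 := lt_sqrt_of_sq_lt (by norm_num)
  have hnum : 0 < 1 + (5 * √5 - 11) / 2 * k := by nlinarith
  have hfactor : 1 - 11 * k - k ^ 2 =
      (1 + (5 * √5 - 11) / 2 * k) * (1 - (11 + 5 * √5) / 2 * k) := by
    linear_combination (25 / 4 * k ^ 2) * h5
  have hu' : uF a = (1 - 11 * k - k ^ 2) / k := by rw [← hu, mul_div_cancel_right₀ _ hk.ne']
  have hsqrt : √(125 + 22 * uF a + uF a ^ 2) = (1 + k ^ 2) / k := by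
    rw [sqrt_eq_iff_mul_self_eq_of_pos (by positivity), hu']
    field_simp
    ring
  have hc : 0 < 11 + 5 * √5 := by positivity
  have hnumerator : 125 + 11 * uF a + 5 * √5 * √(125 + 22 * uF a + uF a ^ 2) =
      (11 + 5 * √5) * (1 + (5 * √5 - 11) / 2 * k) ^ 2 / k := by
    rw [hsqrt, hu', eq_div_iff hk.ne']
    field_simp
    linear_combination (-100 * k - 25 * k ^ 2 * (5 * √5 - 11)) * h5
  rw [hnumerator, hu', hfactor]
  generalize 1 + (5 * √5 - 11) / 2 * k = x at hnum ⊢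
  generalize 1 - (11 + 5 * √5) / 2 * k = y at hden ⊢
  field_simp
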